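/- Let L=(T,V,E) be a link stream in which each T_uv is a finite union of pairwise disjoint closed intervals, let (i,u),(j,v) ∈ T×V with (i,u) ⟶ (j,v), and let k = d((i,u),(j,v)). Let B be the finite set consisting of all event times together with i and j. Consider the sliding sets v₀,I₁,v₁,…,I_k,v_k in which each interval I_m is either a singleton {τ} with τ ∈ B, or an open interval ]τ,τ'[ between two consecutive elements of B. These sliding sets are pairwise disjoint; every shortest path from (i,u) to (j,v) belongs to exactly one of them; and whenever one element of such a sliding set is a shortest path from (i,u) to (j,v), every element of that sliding set is a shortest path from (i,u) to (j,v). Consequently, the set of all shortest paths from (i,u) to (j,v) is a disjoint union of finitely many sliding sets. -/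

import Mathlib

/-!
Common definitions: link streams, paths, distances, latency pairs, etc.
-/

/-- A link stream `L = (T,V,E)` with `T = [tmin, tmax]` an interval of `ℝ`,
nodes `V`, and links `E ⊆ T × (V ⊗ V)` (unordered pairs of distinct nodes). -/
structure LinkStream (V : Type*) where
  tmin : ℝ
  tmax : ℝ
  hminmax : tmin ≤ tmax
  E : Set (ℝ × Sym2 V)
  hT : ∀ p ∈ E, p.1 ∈ Set.Icc tmin tmax
  hND : ∀ p ∈ E, ¬ p.2.IsDiag

/-- starting time of a path of length `k ≥ 1` given by its times (junk value for `k = 0`). -/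
noncomputable def startT {k : ℕ} (times : Fin k → ℝ) : ℝ :=
  if h : 0 < k then times ⟨0, h⟩ else 0

/-- arrival time of a path of length `k ≥ 1` given by its times (junk value for `k = 0`). -/
noncomputable def arrT {k : ℕ} (times : Fin k → ℝ) : ℝ :=
  if _ : 0 < k then times ⟨k - 1, by omega⟩ else 0

/-- The path `v₀,t₁,v₁,…,t_k,v_k` involves `(t,v)`. -/
def Involves {V : Type*} {k : ℕ} (nodes : Fin (k + 1) → V) (times : Fin k → ℝ)
    (t : ℝ) (v : V) : Prop :=
  (∃ i : ℕ, ∃ _ : 1 ≤ i, ∃ _ : i + 1 ≤ k,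
     v = nodes ⟨i, by omega⟩ ∧ times ⟨i - 1, by omega⟩ ≤ t ∧ t ≤ times ⟨i, by omega⟩) ∨
  (∃ h : 1 ≤ k, v = nodes 0 ∧ t = times ⟨0, h⟩) ∨
  (∃ h : 1 ≤ k, v = nodes (Fin.last k) ∧ t = times ⟨k - 1, by omega⟩)

/-- `A` is a finite union of pairwise disjoint closed intervals (possibly singletons). -/
def FiniteClosedUnion (A : Set ℝ) : Prop :=
  ∃ S : Finset (ℝ × ℝ), (∀ p ∈ S, p.1 ≤ p.2) ∧
    (A = ⋃ p ∈ S, Set.Icc p.1 p.2) ∧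
    (S : Set (ℝ × ℝ)).Pairwise fun p q => Disjoint (Set.Icc p.1 p.2) (Set.Icc q.1 q.2)

namespace LinkStream

variable {V : Type*}

/-- `T_uv`: the set of time instants at which `u` and `v` are linked. -/
def Tuv (L : LinkStream V) (u v : V) : Set ℝ := {t | (t, s(u, v)) ∈ L.E}

/-- `G_t`: the graph at time `t`. -/
def Gt (L : LinkStream V) (t : ℝ) : SimpleGraph V where
  Adj u v := (t, s(u, v)) ∈ L.E
  symm := ⟨fun u v h => by change (t, s(u, v)) ∈ L.E at h; change (t, s(v, u)) ∈ L.E; rwa [Sym2.eq_swap] at h⟩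
  loopless := ⟨fun u h => L.hND _ h (by simp)⟩

/-- `(nodes, times)` is a path of length `k` from `(x,u)` to `(y,w)` in `L`. -/
def IsPathOn (L : LinkStream V) (x : ℝ) (u : V) (y : ℝ) (w : V) (k : ℕ)
    (nodes : Fin (k + 1) → V) (times : Fin k → ℝ) : Prop :=
  nodes 0 = u ∧ nodes (Fin.last k) = w ∧ x ≤ y ∧
  (∀ m, x ≤ times m ∧ times m ≤ y) ∧
  (∀ m m' : Fin k, m ≤ m' → times m ≤ times m') ∧
  (∀ m : Fin k, (times m, s(nodes m.castSucc, nodes m.succ)) ∈ L.E)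

/-- `(y,w)` is reachable from `(x,u)`, written `(x,u) ⟶ (y,w)`. -/
def Reach (L : LinkStream V) (x : ℝ) (u : V) (y : ℝ) (w : V) : Prop :=
  ∃ k nodes times, L.IsPathOn x u y w k nodes times

/-- the distance `d((x,u),(y,w))`: minimal length of a path (junk value `0` if unreachable). -/
noncomputable def dist (L : LinkStream V) (x : ℝ) (u : V) (y : ℝ) (w : V) : ℕ :=
  sInf {k | ∃ nodes times, L.IsPathOn x u y w k nodes times}

/-- `(nodes, times)` is a shortest path from `(x,u)` to `(y,w)`. -/
def IsShortest (L : LinkStream V) (x : ℝ) (u : V) (y : ℝ) (w : V) (k : ℕ)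
    (nodes : Fin (k + 1) → V) (times : Fin k → ℝ) : Prop :=
  L.IsPathOn x u y w k nodes times ∧
  ∀ k' nodes' times', L.IsPathOn x u y w k' nodes' times' → k ≤ k'

/-- `(s,a)` is a latency pair from `u` to `w`. -/
def IsLatencyPair (L : LinkStream V) (u w : V) (s a : ℝ) : Prop :=
  s ∈ Set.Icc L.tmin L.tmax ∧ a ∈ Set.Icc L.tmin L.tmax ∧ s ≤ a ∧
  (∃ k nodes times, 1 ≤ k ∧ L.IsPathOn s u a w k nodes times) ∧
  (∀ k nodes (times : Fin k → ℝ), 1 ≤ k → L.IsPathOn s u a w k nodes times →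
     startT times = s ∧ arrT times = a)

/-- `(nodes, times)` is a fastest path from `(i,u)` to `(j,w)`:
a path of minimal duration among all (length ≥ 1) paths from `(i,u)` to `(j,w)`. -/
def IsFastest (L : LinkStream V) (i : ℝ) (u : V) (j : ℝ) (w : V) (k : ℕ)
    (nodes : Fin (k + 1) → V) (times : Fin k → ℝ) : Prop :=
  1 ≤ k ∧ L.IsPathOn i u j w k nodes times ∧
  ∀ k' (nodes' : Fin (k' + 1) → V) (times' : Fin k' → ℝ), 1 ≤ k' →
    L.IsPathOn i u j w k' nodes' times' →
    arrT times - startT times ≤ arrT times' - startT times'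

/-- `(nodes, times)` is a shortest fastest path from `(i,u)` to `(j,w)`. -/
def IsSFP (L : LinkStream V) (i : ℝ) (u : V) (j : ℝ) (w : V) (k : ℕ)
    (nodes : Fin (k + 1) → V) (times : Fin k → ℝ) : Prop :=
  L.IsFastest i u j w k nodes times ∧
  ∀ k' nodes' times', L.IsFastest i u j w k' nodes' times' → k ≤ k'

/-- a path from `(t,x)` to `(t',w)` whose times all lie in `]t,t'[`. -/
def IsPathIoo (L : LinkStream V) (t : ℝ) (x : V) (t' : ℝ) (w : V) (k : ℕ)
    (nodes : Fin (k + 1) → V) (times : Fin k → ℝ) : Prop :=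
  L.IsPathOn t x t' w k nodes times ∧ ∀ m, times m ∈ Set.Ioo t t'

/-- a path from `(t,x)` to `(t',w)` with all times in `]t,t'[`, of minimal length
among all such paths. -/
def IsMinPathIoo (L : LinkStream V) (t : ℝ) (x : V) (t' : ℝ) (w : V) (k : ℕ)
    (nodes : Fin (k + 1) → V) (times : Fin k → ℝ) : Prop :=
  L.IsPathIoo t x t' w k nodes times ∧
  ∀ k' nodes' times', L.IsPathIoo t x t' w k' nodes' times' → k ≤ k'

/-- `t` is an event time: an endpoint of a maximal interval of some `T_uv`. -/
def IsEventTime (L : LinkStream V) (t : ℝ) : Prop :=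
  ∃ u v b e, b ≤ e ∧ Set.Icc b e ⊆ L.Tuv u v ∧
    (∀ b' e', b' ≤ b → e ≤ e' → Set.Icc b' e' ⊆ L.Tuv u v → b' = b ∧ e' = e) ∧
    (t = b ∨ t = e)

end LinkStream

/-- A basic interval with respect to a finite set `B` of times: either a singleton `{τ}`
with `τ ∈ B`, or an open interval `]τ,τ'[` between two consecutive elements of `B`. -/
def BasicInterval (B : Finset ℝ) (I : Set ℝ) : Prop :=
  (∃ τ ∈ B, I = {τ}) ∨
  (∃ τ ∈ B, ∃ τ' ∈ B, τ < τ' ∧ (∀ x ∈ B, ¬(τ < x ∧ x < τ')) ∧ I = Set.Ioo τ τ')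

/-- The sliding set `v₀,I₁,v₁,…,I_k,v_k`: all sequences `v₀,t₁,v₁,…,t_k,v_k` with
`t_m ∈ I_m` for all `m` and `t₁ ≤ t₂ ≤ … ≤ t_k`, seen as a set of pairs
`(nodes, times)`. -/
def SlidingSet {V : Type*} (k : ℕ) (nodes : Fin (k + 1) → V) (I : Fin k → Set ℝ) :
    Set ((Fin (k + 1) → V) × (Fin k → ℝ)) :=
  {p | p.1 = nodes ∧ (∀ m, p.2 m ∈ I m) ∧ ∀ m m' : Fin k, m ≤ m' → p.2 m ≤ p.2 m'}

section

open Set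

theorem FiniteClosedUnion.isCompact {A : Set ℝ} (hA : FiniteClosedUnion A) : IsCompact A := by
  obtain ⟨S, -, rfl, -⟩ := hA
  exact S.isCompact_biUnion fun _ _ => isCompact_Icc

/-- Every point of a compact set of reals lies in a maximal closed interval of that set. -/
theorem IsCompact.exists_maximal_Icc {A : Set ℝ} (hA : IsCompact A) {t : ℝ} (ht : t ∈ A) :
    ∃ b e, t ∈ Icc b e ∧ Icc b e ⊆ A ∧
      ∀ b' e', b' ≤ b → e ≤ e' → Icc b' e' ⊆ A → b' = b ∧ e' = e := by
  have hclosed : IsClosed (connectedComponentIn A t) := by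
    refine isClosed_of_closure_subset ?_
    exact isPreconnected_connectedComponentIn.closure.subset_connectedComponentIn
      (subset_closure (mem_connectedComponentIn ht))
      (closure_minimal (connectedComponentIn_subset A t) hA.isClosed)
  have hcompact : IsCompact (connectedComponentIn A t) :=
    hA.of_isClosed_subset hclosed (connectedComponentIn_subset A t)
  have hIcc := eq_Icc_of_connected_compact (isConnected_connectedComponentIn_iff.2 ht) hcompact
  generalize sInf (connectedComponentIn A t) = b at hIcc
  generalize sSup (connectedComponentIn A t) = e at hIcc
  have htC : t ∈ Icc b e := hIcc ▸ mem_connectedComponentIn ht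
  refine ⟨b, e, htC, hIcc ▸ connectedComponentIn_subset A t, fun b' e' hb he hsub => ?_⟩
  have hle : Icc b' e' ⊆ Icc b e := hIcc ▸ isPreconnected_Icc.subset_connectedComponentIn
    ⟨hb.trans htC.1, htC.2.trans he⟩ hsub
  have hbe : b' ≤ e' := hb.trans (htC.1.trans (htC.2.trans he))
  exact ⟨hb.antisymm (hle (left_mem_Icc.2 hbe)).1, (hle (right_mem_Icc.2 hbe)).2.antisymm he⟩

namespace BasicInterval

variable {B : Finset ℝ} {I J : Set ℝ}

theorem eq_of_mem (hI : BasicInterval B I) (hJ : BasicInterval B J) {t : ℝ} (htI : t ∈ I)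
    (htJ : t ∈ J) : I = J := by
  rcases hI with ⟨a, ha, rfl⟩ | ⟨a, ha, a', ha', -, hac, rfl⟩ <;>
    rcases hJ with ⟨b, hb, rfl⟩ | ⟨b, hb, b', hb', -, hbc, rfl⟩
  · rw [← mem_singleton_iff.1 htI, ← mem_singleton_iff.1 htJ]
  · exact absurd (mem_singleton_iff.1 htI ▸ htJ) (hbc a ha)
  · exact absurd (mem_singleton_iff.1 htJ ▸ htI) (hac b hb)
  · obtain ⟨h1, h2⟩ := htI
    obtain ⟨h3, h4⟩ := htJ
    have hab : a = b := by grind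
    have hab' : a' = b' := by grind
    rw [hab, hab']

theorem exists_mem {i j t : ℝ} (hi : i ∈ B) (hj : j ∈ B) (hit : i ≤ t) (htj : t ≤ j) :
    ∃ I, BasicInterval B I ∧ t ∈ I := by
  by_cases ht : t ∈ B
  · exact ⟨{t}, .inl ⟨t, ht, rfl⟩, rfl⟩
  have hlt : i < t := hit.lt_of_ne fun h => ht (h ▸ hi)
  have hgt : t < j := htj.lt_of_ne fun h => ht (h ▸ hj)
  obtain ⟨a, ha, hamax⟩ := (B.filter (· < t)).exists_max_image id ⟨i, by simp [hi, hlt]⟩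
  obtain ⟨b, hb, hbmin⟩ := (B.filter (t < ·)).exists_min_image id ⟨j, by simp [hj, hgt]⟩
  simp only [Finset.mem_filter, id] at ha hb hamax hbmin
  refine ⟨Ioo a b, .inr ⟨a, ha.1, b, hb.1, ha.2.trans hb.2, fun x hx hxab => ?_, rfl⟩,
    ha.2, hb.2⟩
  rcases lt_trichotomy x t with h | rfl | h
  · exact (hamax x ⟨hx, h⟩).not_gt hxab.1
  · exact ht hx
  · exact (hbmin x ⟨hx, h⟩).not_gt hxab.2

/-- A basic interval meeting a closed interval with endpoints in `B` is contained in it. -/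
theorem subset_Icc (hI : BasicInterval B I) {b e t : ℝ} (hb : b ∈ B) (he : e ∈ B) (ht : t ∈ I)
    (hbe : t ∈ Icc b e) : I ⊆ Icc b e := by
  rcases hI with ⟨a, ha, rfl⟩ | ⟨a, ha, a', ha', -, hac, rfl⟩
  · rintro s rfl
    exact mem_singleton_iff.1 ht ▸ hbe
  · intro s hs
    have hba : b ≤ a := not_lt.1 fun h => hac b hb ⟨h, hbe.1.trans_lt ht.2⟩
    have hae : a' ≤ e := not_lt.1 fun h => hac e he ⟨ht.1.trans_le hbe.2, h⟩
    exact ⟨hba.trans hs.1.le, hs.2.le.trans hae⟩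

end BasicInterval

theorem finite_setOf_basicInterval (B : Finset ℝ) : {I | BasicInterval B I}.Finite := by
  refine ((B.finite_toSet.image fun τ => ({τ} : Set ℝ)).union
    ((B.finite_toSet.prod B.finite_toSet).image fun p : ℝ × ℝ => Ioo p.1 p.2)).subset ?_
  rintro I (⟨τ, hτ, rfl⟩ | ⟨τ, hτ, τ', hτ', -, -, rfl⟩)
  · exact .inl ⟨τ, hτ, rfl⟩
  · exact .inr ⟨(τ, τ'), ⟨hτ, hτ'⟩, rfl⟩

theorem disjoint_slidingSet {V : Type*} {k : ℕ} {B : Finset ℝ} {nodes nodes' : Fin (k + 1) → V}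
    {I I' : Fin k → Set ℝ} (hI : ∀ m, BasicInterval B (I m)) (hI' : ∀ m, BasicInterval B (I' m))
    (hne : (nodes, I) ≠ (nodes', I')) :
    Disjoint (SlidingSet k nodes I) (SlidingSet k nodes' I') := by
  refine Set.disjoint_left.2 fun p ⟨hp, hpI, _⟩ ⟨hp', hpI', _⟩ => hne ?_
  exact Prod.ext (hp.symm.trans hp') (funext fun m => (hI m).eq_of_mem (hI' m) (hpI m) (hpI' m))

namespace LinkStream

variable {V : Type*} {L : LinkStream V} {B : Finset ℝ}

theorem subset_Tuv_of_basicInterval {u v : V} (hL : FiniteClosedUnion (L.Tuv u v))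
    (hB : ∀ t, L.IsEventTime t → t ∈ B) {I : Set ℝ} (hI : BasicInterval B I) {t : ℝ}
    (htI : t ∈ I) (ht : t ∈ L.Tuv u v) : I ⊆ L.Tuv u v := by
  obtain ⟨b, e, hbe, hsub, hmax⟩ := hL.isCompact.exists_maximal_Icc ht
  have hle := hbe.1.trans hbe.2
  exact (hI.subset_Icc (hB b ⟨u, v, b, e, hle, hsub, hmax, .inl rfl⟩)
    (hB e ⟨u, v, b, e, hle, hsub, hmax, .inr rfl⟩) htI hbe).trans hsub

theorem IsShortest.of_mem_slidingSet (hL : ∀ u v : V, FiniteClosedUnion (L.Tuv u v))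
    (hB : ∀ t, L.IsEventTime t → t ∈ B) {i j : ℝ} (hi : i ∈ B) (hj : j ∈ B) {u v : V} {k : ℕ}
    {nodes : Fin (k + 1) → V} {I : Fin k → Set ℝ} (hI : ∀ m, BasicInterval B (I m))
    {times times' : Fin k → ℝ} (h : (nodes, times) ∈ SlidingSet k nodes I)
    (h' : (nodes, times') ∈ SlidingSet k nodes I) (hs : L.IsShortest i u j v k nodes times) :
    L.IsShortest i u j v k nodes times' := by
  obtain ⟨⟨hu, hv, hij, hbd, -, hE⟩, hmin⟩ := hs
  exact ⟨⟨hu, hv, hij, fun m => (hI m).subset_Icc hi hj (h.2.1 m) (hbd m) (h'.2.1 m), h'.2.2,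
    fun m => subset_Tuv_of_basicInterval (hL _ _) hB (hI m) (h.2.1 m) (hE m) (h'.2.1 m)⟩, hmin⟩

theorem IsShortest.exists_slidingSet {i j : ℝ} (hi : i ∈ B) (hj : j ∈ B) {u v : V} {k : ℕ}
    {nodes : Fin (k + 1) → V} {times : Fin k → ℝ} (hs : L.IsShortest i u j v k nodes times) :
    ∃ I : Fin k → Set ℝ, (∀ m, BasicInterval B (I m)) ∧
      (nodes, times) ∈ SlidingSet k nodes I := by
  obtain ⟨⟨-, -, -, hbd, hmono, -⟩, -⟩ := hs
  choose I hI htI using fun m => BasicInterval.exists_mem hi hj (hbd m).1 (hbd m).2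
  exact ⟨I, hI, rfl, htI, hmono⟩

end LinkStream

end

/-- let `B` be the finite set of event times together with `i` and `j`, and
`k = d((i,u),(j,v))`. The sliding sets whose intervals are basic with respect to `B` are
pairwise disjoint; every shortest path from `(i,u)` to `(j,v)` belongs to exactly one of
them; whenever one element of such a sliding set is a shortest path from `(i,u)` to
`(j,v)`, every element of it is; and consequently the set of all shortest paths from
`(i,u)` to `(j,v)` is a disjoint union of finitely many such sliding sets. -/
theorem shortest_paths_disjoint_union_of_sliding_sets {V : Type*} [Fintype V]
    (L : LinkStream V) (hFCU : ∀ u v : V, FiniteClosedUnion (L.Tuv u v))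
    (i j : ℝ) (hi : i ∈ Set.Icc L.tmin L.tmax) (hj : j ∈ Set.Icc L.tmin L.tmax)
    (u v : V) (hreach : L.Reach i u j v)
    (k : ℕ) (hk : k = L.dist i u j v)
    (B : Finset ℝ) (hB : ∀ t, t ∈ B ↔ (L.IsEventTime t ∨ t = i ∨ t = j)) :
    (∀ (nodes nodes' : Fin (k + 1) → V) (I I' : Fin k → Set ℝ),
      (∀ m, BasicInterval B (I m)) → (∀ m, BasicInterval B (I' m)) →
      (nodes, I) ≠ (nodes', I') →
      Disjoint (SlidingSet k nodes I) (SlidingSet k nodes' I')) ∧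
    (∀ (nodes : Fin (k + 1) → V) (times : Fin k → ℝ),
      L.IsShortest i u j v k nodes times →
      ∃! q : (Fin (k + 1) → V) × (Fin k → Set ℝ),
        (∀ m, BasicInterval B (q.2 m)) ∧ (nodes, times) ∈ SlidingSet k q.1 q.2) ∧
    (∀ (nodes : Fin (k + 1) → V) (I : Fin k → Set ℝ), (∀ m, BasicInterval B (I m)) →
      ∀ times times' : Fin k → ℝ,
        (nodes, times) ∈ SlidingSet k nodes I → (nodes, times') ∈ SlidingSet k nodes I →
        L.IsShortest i u j v k nodes times → L.IsShortest i u j v k nodes times') ∧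
    (∃ F : Finset ((Fin (k + 1) → V) × (Fin k → Set ℝ)),
      (∀ q ∈ F, ∀ m, BasicInterval B (q.2 m)) ∧
      ((F : Set ((Fin (k + 1) → V) × (Fin k → Set ℝ))).Pairwise fun q q' =>
        Disjoint (SlidingSet k q.1 q.2) (SlidingSet k q'.1 q'.2)) ∧
      {p : (Fin (k + 1) → V) × (Fin k → ℝ) | L.IsShortest i u j v k p.1 p.2}
        = ⋃ q ∈ F, SlidingSet k q.1 q.2) := by
  have hiB : i ∈ B := (hB i).2 (.inr (.inl rfl))
  have hjB : j ∈ B := (hB j).2 (.inr (.inr rfl))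
  have hev : ∀ t, L.IsEventTime t → t ∈ B := fun t ht => (hB t).2 (.inl ht)
  refine ⟨fun _ _ _ _ hI hI' hne => disjoint_slidingSet hI hI' hne, fun nodes times hs => ?_,
    fun _ _ hI _ _ h h' hs => hs.of_mem_slidingSet hFCU hev hiB hjB hI h h', ?_⟩
  · obtain ⟨I, hI, hmem⟩ := hs.exists_slidingSet hiB hjB
    refine ⟨(nodes, I), ⟨hI, hmem⟩, fun q ⟨hq, hqmem⟩ => ?_⟩
    by_contra hne
    exact Set.disjoint_left.1 (disjoint_slidingSet hq hI hne) hqmem hmem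
  · have hfin : {q : (Fin (k + 1) → V) × (Fin k → Set ℝ) | (∀ m, BasicInterval B (q.2 m)) ∧
        ∃ times, (q.1, times) ∈ SlidingSet k q.1 q.2 ∧
          L.IsShortest i u j v k q.1 times}.Finite :=
      (Set.finite_univ.prod (Set.Finite.pi' fun _ => finite_setOf_basicInterval B)).subset
        fun q hq => ⟨Set.mem_univ _, hq.1⟩
    refine ⟨hfin.toFinset, fun q hq => (hfin.mem_toFinset.1 hq).1, fun q hq q' hq' hne =>
      disjoint_slidingSet (hfin.mem_toFinset.1 hq).1 (hfin.mem_toFinset.1 hq').1 hne, ?_⟩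
    ext ⟨nodes, times⟩
    simp only [Set.mem_iUnion, Set.Finite.mem_toFinset, Set.mem_ofPred_eq, exists_prop]
    constructor
    · intro hs
      obtain ⟨I, hI, hmem⟩ := hs.exists_slidingSet hiB hjB
      exact ⟨(nodes, I), ⟨hI, times, hmem, hs⟩, hmem⟩
    · rintro ⟨⟨nodes', I⟩, ⟨hI, times', hmem', hs⟩, hmem⟩
      obtain rfl : nodes = nodes' := hmem.1
      exact hs.of_mem_slidingSet hFCU hev hiB hjB hI hmem' hmem
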